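/- Let L be a C^k (k ≥ 2) Tonelli Lagrangian on T𝕋ⁿ without conjugate points, with Euler–Lagrange flow (φ_t). Then for every t > 0 and every x ∈ ℝⁿ, the map F : ℝⁿ → ℝⁿ sending v to the first component of φ_t(x, v) is a C^{k−1} diffeomorphism of ℝⁿ onto ℝⁿ. -/

import Mathlib

open MeasureTheory
open scoped NNReal

noncomputable section

abbrev E (n : ℕ) : Type := Fin n → ℝ

/-- The vector of `ℝⁿ` whose coordinates are the integers `m i`. -/
def intVec {n : ℕ} (m : Fin n → ℤ) : E n := fun i => (m i : ℝ)

/-- A Tonelli Lagrangian on `T𝕋ⁿ`, identified with a `ℤⁿ`-periodic (in `x`) function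
on `ℝⁿ × ℝⁿ` which is `Cᵏ`, uniformly superlinear in `v` and with positive definite
fiberwise Hessian. -/
structure IsTonelliLagrangian (n : ℕ) (k : ℕ∞) (L : E n × E n → ℝ) : Prop where
  smooth : ContDiff ℝ k L
  periodic : ∀ (x v : E n) (m : Fin n → ℤ), L (x + intVec m, v) = L (x, v)
  superlinear : ∀ C : ℝ, ∃ R : ℝ, ∀ (x v : E n), R ≤ ‖v‖ → C * ‖v‖ ≤ L (x, v)
  posdef : ∀ (x v w : E n), w ≠ 0 →
    0 < fderiv ℝ (fun v' => fderiv ℝ (fun v'' => L (x, v'')) v' w) v w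

/-- Partial differential of `L` in the fiber (velocity) direction. -/
def partialV (n : ℕ) (L : E n × E n → ℝ) (x v : E n) : E n →L[ℝ] ℝ :=
  fderiv ℝ (fun v' => L (x, v')) v

/-- Partial differential of `L` in the base (position) direction. -/
def partialX (n : ℕ) (L : E n × E n → ℝ) (x v : E n) : E n →L[ℝ] ℝ :=
  fderiv ℝ (fun x' => L (x', v)) x

/-- A `C²` curve satisfying the Euler–Lagrange equation
`d/dt (∂L/∂v(γ, γ')) = ∂L/∂x(γ, γ')`. -/
def IsExtremal (n : ℕ) (L : E n × E n → ℝ) (γ : ℝ → E n) : Prop :=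
  ContDiff ℝ 2 γ ∧
  ∀ t : ℝ, HasDerivAt (fun s => partialV n L (γ s) (deriv γ s))
    (partialX n L (γ t) (deriv γ t)) t

/-- `φ` is the (complete, `C^{k-1}`) Euler–Lagrange flow of `L` on `ℝⁿ × ℝⁿ`:
`φ t (x,v) = (γ t, γ' t)` where `γ` is the extremal curve with `(γ 0, γ' 0) = (x, v)`. -/
def IsELFlow (n : ℕ) (k : ℕ) (L : E n × E n → ℝ)
    (φ : ℝ → E n × E n → E n × E n) : Prop :=
  ContDiff ℝ ((k - 1 : ℕ) : ℕ∞) (fun p : ℝ × (E n × E n) => φ p.1 p.2) ∧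
  (∀ z : E n × E n, φ 0 z = z) ∧
  ∀ x v : E n, IsExtremal n L (fun t => (φ t (x, v)).1) ∧
    ∀ t : ℝ, (φ t (x, v)).2 = deriv (fun s => (φ s (x, v)).1) t

/-- The flow `φ` has no conjugate points: for `t ≠ 0` the image of the vertical
subspace `{0} × ℝⁿ` under `Dφ_t(z)` meets `{0} × ℝⁿ` only in `0`. -/
def NoConjugatePoints (n : ℕ) (φ : ℝ → E n × E n → E n × E n) : Prop :=
  ∀ (z : E n × E n) (t : ℝ), t ≠ 0 → ∀ w : E n,
    (fderiv ℝ (φ t) z (0, w)).1 = 0 → w = 0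

/-- The absolutely continuous curve starting at `x` with derivative `g`. -/
def curveOf (n : ℕ) (x : E n) (g : ℝ → E n) : ℝ → E n :=
  fun s => x + ∫ u in (0:ℝ)..s, g u

/-- `Acost n L t x y` = the infimum of the Lagrangian action over all absolutely
continuous curves `c : [0,t] → ℝⁿ` with `c 0 = x` and `c t = y`. -/
def Acost (n : ℕ) (L : E n × E n → ℝ) (t : ℝ) (x y : E n) : ℝ :=
  sInf { A : ℝ | ∃ g : ℝ → E n,
    IntervalIntegrable g volume 0 t ∧
    curveOf n x g t = y ∧
    IntervalIntegrable (fun s => L (curveOf n x g s, g s)) volume 0 t ∧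
    A = ∫ s in (0:ℝ)..t, L (curveOf n x g s, g s) }

open Set Filter Topology

section ParametricIntegral

variable {P F : Type*} [NormedAddCommGroup P] [NormedSpace ℝ P]
  [NormedAddCommGroup F] [NormedSpace ℝ F]

theorem continuous_fderiv_left {f : P → ℝ → F} (hf : ContDiff ℝ 1 (Function.uncurry f)) :
    Continuous (fun q : P × ℝ => fderiv ℝ (fun p => f p q.2) q.1) := by
  have h : ∀ q : P × ℝ, fderiv ℝ (fun p => f p q.2) q.1 =
      (fderiv ℝ (Function.uncurry f) q).comp (ContinuousLinearMap.inl ℝ P ℝ) := fun q => by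
    have h1 := (hf.differentiable one_ne_zero q).hasFDerivAt
    exact (HasFDerivAt.comp (f := fun p => (p, q.2)) q.1 h1
      (hasFDerivAt_prodMk_left q.1 q.2)).fderiv
  simp only [h]
  exact (hf.continuous_fderiv one_ne_zero).clm_comp continuous_const

theorem hasStrictFDerivAt_intervalIntegral [ProperSpace P] {f : P → ℝ → F}
    (hf : ContDiff ℝ 1 (Function.uncurry f)) (a b : ℝ) (p : P) :
    HasStrictFDerivAt (fun p => ∫ s in a..b, f p s)
      (∫ s in a..b, fderiv ℝ (fun p => f p s) p) p := by
  have hc := continuous_fderiv_left hf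
  have hfs : ∀ p s, HasFDerivAt (fun p => f p s) (fderiv ℝ (fun p => f p s) p) p := fun p s =>
    ((hf.differentiable one_ne_zero).comp
      (f := fun p => (p, s)) (by fun_prop) p).hasFDerivAt
  refine hasStrictFDerivAt_of_hasFDerivAt_of_continuousAt
    (f' := fun p => ∫ s in a..b, fderiv ℝ (fun p => f p s) p) (.of_forall fun p => ?_) ?_
  · obtain ⟨C, hC⟩ := ((isCompact_closedBall p 1).prod (isCompact_uIcc (a := a) (b := b))
      ).exists_bound_of_continuousOn hc.continuousOn
    refine intervalIntegral.hasFDerivAt_integral_of_dominated_of_fderiv_le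
      (F' := fun p s => fderiv ℝ (fun p => f p s) p) (bound := fun _ => C)
      (Metric.closedBall_mem_nhds p one_pos) (.of_forall fun q => ?_) ?_ ?_ ?_ ?_ ?_
    · exact (hf.continuous.comp (Continuous.prodMk_right q)).aestronglyMeasurable
    · exact (hf.continuous.comp (Continuous.prodMk_right p)).intervalIntegrable _ _
    · exact (hc.comp (Continuous.prodMk_right p)).aestronglyMeasurable
    · exact .of_forall fun s hs q hq => hC (q, s) ⟨hq, uIoc_subset_uIcc hs⟩
    · exact intervalIntegrable_const
    · exact .of_forall fun s _ q _ => hfs q s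
  · exact (intervalIntegral.continuous_parametric_intervalIntegral_of_continuous'
      (f := fun p s => fderiv ℝ (fun p => f p s) p) hc a b).continuousAt

end ParametricIntegral

section Lagrangian

variable {n : ℕ} {L : E n × E n → ℝ}

theorem partialV_eq (hL : Differentiable ℝ L) (x v w : E n) :
    partialV n L x v w = fderiv ℝ L (x, v) (0, w) := by
  have h := (HasFDerivAt.comp (f := fun v => (x, v)) v (hL (x, v)).hasFDerivAt
    (hasFDerivAt_prodMk_right x v)).fderiv
  exact congrArg (· w) h

theorem partialX_eq (hL : Differentiable ℝ L) (x v w : E n) :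
    partialX n L x v w = fderiv ℝ L (x, v) (w, 0) := by
  have h := (HasFDerivAt.comp (f := fun x => (x, v)) x (hL (x, v)).hasFDerivAt
    (hasFDerivAt_prodMk_left x v)).fderiv
  exact congrArg (· w) h

theorem fderiv_eq_partial (hL : Differentiable ℝ L) (x v a b : E n) :
    fderiv ℝ L (x, v) (a, b) = partialX n L x v a + partialV n L x v b := by
  rw [partialV_eq hL, partialX_eq hL, ← map_add]
  simp

theorem continuous_partialV (hL : ContDiff ℝ 1 L) :
    Continuous (fun z : E n × E n => partialV n L z.1 z.2) := by
  have h : ∀ z : E n × E n, partialV n L z.1 z.2 =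
      (fderiv ℝ L z).comp (ContinuousLinearMap.inr ℝ (E n) (E n)) := fun z => by
    ext w
    simp [partialV_eq (hL.differentiable one_ne_zero)]
  simp only [h]
  exact (hL.continuous_fderiv one_ne_zero).clm_comp continuous_const

/-- Fiberwise convexity: the graph of `L (x, ·)` lies above its tangent hyperplanes. -/
theorem add_partialV_le (hL : ContDiff ℝ 2 L)
    (hpos : ∀ (x v w : E n), w ≠ 0 →
      0 < fderiv ℝ (fun v' => fderiv ℝ (fun v'' => L (x, v'')) v' w) v w) (x v z : E n) :
    L (x, v) + partialV n L x v (z - v) ≤ L (x, z) := by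
  set f : E n → ℝ := fun v => L (x, v) with hf
  have hfc : ContDiff ℝ 2 f := hL.comp (contDiff_prodMk_right x)
  set w := z - v with hw
  have hline : ∀ s : ℝ, HasDerivAt (fun s : ℝ => v + s • w) w s := fun s => by
    simpa using ((hasDerivAt_id s).smul_const w).const_add v
  have h1 : ∀ s : ℝ, HasDerivAt (fun s : ℝ => f (v + s • w)) (fderiv ℝ f (v + s • w) w) s :=
    fun s => ((hfc.differentiable two_ne_zero _).hasFDerivAt).comp_hasDerivAt s (hline s)
  have hd : Differentiable ℝ (fun v => fderiv ℝ f v w) :=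
    ((hfc.fderiv_right (m := 1) (by norm_num)).clm_apply contDiff_const).differentiable
      one_ne_zero
  have h2 : ∀ s : ℝ, HasDerivAt (fun s : ℝ => fderiv ℝ f (v + s • w) w)
      (fderiv ℝ (fun v => fderiv ℝ f v w) (v + s • w) w) s :=
    fun s => ((hd _).hasFDerivAt).comp_hasDerivAt s (hline s)
  have hmono : Monotone (fun s : ℝ => fderiv ℝ f (v + s • w) w) := by
    refine monotone_of_deriv_nonneg (fun s => (h2 s).differentiableAt) fun s => ?_
    rw [(h2 s).deriv]
    rcases eq_or_ne w 0 with h | h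
    · simp [h]
    · exact (hpos x _ w h).le
  obtain ⟨c, hc, hc'⟩ := exists_hasDerivAt_eq_slope _ _ one_pos
    (fun s _ => (h1 s).continuousAt.continuousWithinAt) (fun s _ => h1 s)
  have h3 : fderiv ℝ f (v + (0 : ℝ) • w) w ≤ fderiv ℝ f (v + c • w) w := hmono hc.1.le
  rw [hc'] at h3
  simp only [zero_smul, add_zero, one_smul, sub_zero, div_one, hw, add_sub_cancel] at h3
  change f v + fderiv ℝ f v (z - v) ≤ f z
  linarith

end Lagrangian

section Energy

variable {n : ℕ} {k : ℕ∞} {L : E n × E n → ℝ}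

/-- The energy `∂L/∂v(x,v)·v - L(x,v)`. -/
def lagrangianEnergy (n : ℕ) (L : E n × E n → ℝ) (x v : E n) : ℝ :=
  partialV n L x v v - L (x, v)

theorem IsExtremal.energy_eq (hL : Differentiable ℝ L) {γ : ℝ → E n} (hγ : IsExtremal n L γ)
    (s t : ℝ) : lagrangianEnergy n L (γ s) (deriv γ s) = lagrangianEnergy n L (γ t) (deriv γ t) := by
  have hγ1 : ∀ t, HasDerivAt γ (deriv γ t) t := fun t =>
    (hγ.1.differentiable two_ne_zero t).hasDerivAt
  have hγ2 : ∀ t, HasDerivAt (deriv γ) (deriv (deriv γ) t) t := fun t =>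
    ((ContDiff.differentiable (n := 1) (hγ.1.deriv' (n := 1)) one_ne_zero) t).hasDerivAt
  have hd : ∀ t, HasDerivAt (fun t => lagrangianEnergy n L (γ t) (deriv γ t)) 0 t := fun t => by
    have h1 := (hγ.2 t).clm_apply (hγ2 t)
    have h2 := (hL (γ t, deriv γ t)).hasFDerivAt.comp_hasDerivAt t ((hγ1 t).prodMk (hγ2 t))
    rw [fderiv_eq_partial hL] at h2
    refine (h1.sub h2).congr_deriv ?_
    simp
  exact is_const_of_deriv_eq_zero (fun t => (hd t).differentiableAt) (fun t => (hd t).deriv) s t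

theorem IsTonelliLagrangian.contDiff_two (hL : IsTonelliLagrangian n k L) (hk : 2 ≤ k) :
    ContDiff ℝ 2 L :=
  hL.smooth.of_le (WithTop.coe_le_coe.2 hk)

theorem IsTonelliLagrangian.energy_periodic (hL : IsTonelliLagrangian n k L) (x v : E n)
    (m : Fin n → ℤ) : lagrangianEnergy n L (x + intVec m) v = lagrangianEnergy n L x v := by
  simp [lagrangianEnergy, partialV, hL.periodic]

theorem IsTonelliLagrangian.exists_energy_le (hL : IsTonelliLagrangian n k L) (hk : 1 ≤ k)
    (R : ℝ) : ∃ C, ∀ x v : E n, ‖v‖ ≤ R → lagrangianEnergy n L x v ≤ C := by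
  have hL1 : ContDiff ℝ 1 L := hL.smooth.of_le (by exact_mod_cast hk)
  have hc : Continuous (fun z : E n × E n => lagrangianEnergy n L z.1 z.2) :=
    ((continuous_partialV hL1).clm_apply continuous_snd).sub hL1.continuous
  obtain ⟨C, hC⟩ := ((isCompact_closedBall (0 : E n) 1).prod
    (isCompact_closedBall (0 : E n) R)).exists_bound_of_continuousOn hc.continuousOn
  refine ⟨C, fun x v hv => ?_⟩
  have hx : x = (fun i => Int.fract (x i)) + intVec fun i => ⌊x i⌋ := by
    ext i
    simp [intVec]
  rw [hx, hL.energy_periodic]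
  refine (le_abs_self _).trans (hC ((fun i => Int.fract (x i)), v) ⟨?_, by simpa using hv⟩)
  rw [mem_closedBall_zero_iff, pi_norm_le_iff_of_nonneg zero_le_one]
  intro i
  rw [Real.norm_of_nonneg (Int.fract_nonneg _)]
  exact (Int.fract_lt_one _).le

theorem IsTonelliLagrangian.exists_norm_le_of_energy_le (hL : IsTonelliLagrangian n k L)
    (hk : 2 ≤ k) (x : E n) (C : ℝ) :
    ∃ R, ∀ v : E n, lagrangianEnergy n L x v ≤ C → ‖v‖ ≤ R := by
  have hL2 := hL.contDiff_two hk
  obtain ⟨M, hM⟩ := (isCompact_closedBall (0 : E n) 1).exists_bound_of_continuousOn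
    (f := fun v => L (x, v)) (hL2.continuous.comp (Continuous.prodMk_right x)).continuousOn
  obtain ⟨R, hR⟩ := hL.superlinear (C + 2 * M + 1)
  refine ⟨max 1 R, fun v hv => ?_⟩
  by_contra! hlt
  obtain ⟨h1, h2⟩ := max_lt_iff.1 hlt
  have hv0 : 0 < ‖v‖ := one_pos.trans h1
  have hM0 := (abs_le.1 (hM 0 (by simp))).2
  have hMnn : 0 ≤ M := (norm_nonneg _).trans (hM 0 (by simp))
  have hu : ‖‖v‖⁻¹ • v‖ = 1 := by rw [norm_smul, norm_inv, norm_norm, inv_mul_cancel₀ hv0.ne']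
  have hMu := (abs_le.1 (hM (‖v‖⁻¹ • v) (by simp [hu]))).2
  have hc0 := add_partialV_le hL2 hL.posdef x v 0
  have hcu := add_partialV_le hL2 hL.posdef x v (‖v‖⁻¹ • v)
  have hs := hR x v h2.le
  simp only [zero_sub, map_neg, map_sub, map_smul, smul_eq_mul] at hc0 hcu hM0 hMu
  set p := partialV n L x v v
  have hp : (C + M + 1) * ‖v‖ ≤ p := by nlinarith
  have hq : C + M + 1 ≤ ‖v‖⁻¹ * p := by
    rw [inv_mul_eq_div, le_div_iff₀ hv0]
    exact hp
  have he : lagrangianEnergy n L x v = p - L (x, v) := rfl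
  linarith

end Energy

section Flow

variable {n k : ℕ} {L : E n × E n → ℝ} {φ : ℝ → E n × E n → E n × E n}

theorem IsELFlow.contDiff_one (hφ : IsELFlow n k L φ) (hk : 2 ≤ k) :
    ContDiff ℝ 1 (fun p : ℝ × (E n × E n) => φ p.1 p.2) :=
  hφ.1.of_le (by exact_mod_cast (by omega : 1 ≤ k - 1))

theorem IsELFlow.hasDerivAt_fst (hφ : IsELFlow n k L φ) (x v : E n) (t : ℝ) :
    HasDerivAt (fun t => (φ t (x, v)).1) (φ t (x, v)).2 t := by
  rw [(hφ.2.2 x v).2 t]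
  exact ((hφ.2.2 x v).1.1.differentiable two_ne_zero t).hasDerivAt

theorem IsELFlow.hasDerivAt_partialV (hφ : IsELFlow n k L φ) (x v : E n) (t : ℝ) :
    HasDerivAt (fun t => partialV n L (φ t (x, v)).1 (φ t (x, v)).2)
      (partialX n L (φ t (x, v)).1 (φ t (x, v)).2) t := by
  simpa only [(hφ.2.2 x v).2] using (hφ.2.2 x v).1.2 t

theorem IsELFlow.energy_eq (hφ : IsELFlow n k L φ) (hL : Differentiable ℝ L) (x v : E n)
    (t : ℝ) : lagrangianEnergy n L (φ t (x, v)).1 (φ t (x, v)).2 = lagrangianEnergy n L x v := by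
  have h := (hφ.2.2 x v).1.energy_eq hL t 0
  simpa only [← (hφ.2.2 x v).2, hφ.2.1] using h

theorem IsELFlow.fst_eq_add_integral (hφ : IsELFlow n k L φ) (hk : 2 ≤ k) (x v : E n) (t : ℝ) :
    (φ t (x, v)).1 = x + ∫ s in (0 : ℝ)..t, (φ s (x, v)).2 := by
  have hc : Continuous fun s => (φ s (x, v)).2 :=
    continuous_snd.comp ((hφ.contDiff_one hk).continuous.comp (Continuous.prodMk_left (x, v)))
  rw [intervalIntegral.integral_eq_sub_of_hasDerivAt (fun s _ => hφ.hasDerivAt_fst x v s)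
    (hc.intervalIntegrable _ _), hφ.2.1]
  simp

/-- The flow restricted to the fiber over `x`, with the velocity as first argument. -/
theorem IsELFlow.contDiff_fiber (hφ : IsELFlow n k L φ) (hk : 2 ≤ k) (x : E n) :
    ContDiff ℝ 1 (Function.uncurry fun (v : E n) (s : ℝ) => φ s (x, v)) :=
  (hφ.contDiff_one hk).comp (contDiff_snd.prodMk (contDiff_const.prodMk contDiff_fst))

theorem IsELFlow.differentiable_fiber (hφ : IsELFlow n k L φ) (hk : 2 ≤ k) (x : E n) (s : ℝ) :
    Differentiable ℝ (fun v : E n => φ s (x, v)) :=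
  ((hφ.contDiff_fiber hk x).differentiable one_ne_zero).comp (f := fun v => (v, s)) (by fun_prop)

theorem IsELFlow.fderiv_fiber (hφ : IsELFlow n k L φ) (hk : 2 ≤ k) (x v w : E n) (s : ℝ) :
    fderiv ℝ (fun v : E n => φ s (x, v)) v w = fderiv ℝ (φ s) (x, v) (0, w) := by
  have hd : Differentiable ℝ (φ s) := ((hφ.contDiff_one hk).differentiable one_ne_zero).comp
    (f := fun z => (s, z)) (by fun_prop)
  have h := (HasFDerivAt.comp (f := fun v => (x, v)) v (hd (x, v)).hasFDerivAt
    (hasFDerivAt_prodMk_right x v)).fderiv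
  exact congrArg (· w) h

/-- The Jacobi field with vertical initial condition `(0, w)`. -/
theorem IsELFlow.hasDerivAt_jacobi (hφ : IsELFlow n k L φ) (hk : 2 ≤ k) (x v w : E n) (t : ℝ) :
    HasDerivAt (fun s => (fderiv ℝ (fun v : E n => φ s (x, v)) v w).1)
      (fderiv ℝ (fun v : E n => φ t (x, v)) v w).2 t := by
  have hc : Continuous fun s => fderiv ℝ (fun v : E n => φ s (x, v)) v :=
    (continuous_fderiv_left (hφ.contDiff_fiber hk x)).comp (Continuous.prodMk_right v)
  have hsnd : ∀ s, fderiv ℝ (fun v : E n => (φ s (x, v)).2) v =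
      (ContinuousLinearMap.snd ℝ _ _).comp (fderiv ℝ (fun v : E n => φ s (x, v)) v) := fun s =>
    ((hφ.differentiable_fiber hk x s v).hasFDerivAt.snd).fderiv
  have hint : ∀ s, (fderiv ℝ (fun v : E n => φ s (x, v)) v w).1 =
      ∫ u in (0 : ℝ)..s, (fderiv ℝ (fun v : E n => φ u (x, v)) v w).2 := fun s => by
    have h1 := (hφ.differentiable_fiber hk x s v).hasFDerivAt.fst
    have h2 := (hasStrictFDerivAt_intervalIntegral (f := fun (v : E n) s => (φ s (x, v)).2)
      (contDiff_snd.comp (hφ.contDiff_fiber hk x)) 0 s v).hasFDerivAt.const_add x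
    simp only [hφ.fst_eq_add_integral hk] at h1
    have h3 := congrArg (· w) (h1.unique h2)
    simp only [hsnd] at h3
    rw [ContinuousLinearMap.intervalIntegral_apply] at h3
    · exact h3
    · exact (continuous_const.clm_comp hc).intervalIntegrable _ _
  simp only [hint]
  have hc' : Continuous fun u => (fderiv ℝ (fun v : E n => φ u (x, v)) v w).2 :=
    continuous_snd.comp (hc.clm_apply continuous_const)
  exact intervalIntegral.integral_hasDerivAt_right (hc'.intervalIntegrable _ _)
    hc'.stronglyMeasurable.stronglyMeasurableAtFilter hc'.continuousAt

/-- First variation of the action with respect to the initial velocity. -/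
theorem IsELFlow.hasFDerivAt_action (hφ : IsELFlow n k L φ) (hk : 2 ≤ k) (hL : ContDiff ℝ 1 L)
    (x v : E n) (t : ℝ) :
    HasFDerivAt (fun v => ∫ s in (0 : ℝ)..t, L (φ s (x, v)))
      ((partialV n L (φ t (x, v)).1 (φ t (x, v)).2).comp
        ((ContinuousLinearMap.fst ℝ _ _).comp (fderiv ℝ (fun v : E n => φ t (x, v)) v))) v := by
  have hLd := hL.differentiable one_ne_zero
  have hcd : ContDiff ℝ 1 (Function.uncurry fun (v : E n) (s : ℝ) => L (φ s (x, v))) :=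
    hL.comp (hφ.contDiff_fiber hk x)
  have h := (hasStrictFDerivAt_intervalIntegral hcd 0 t v).hasFDerivAt
  refine h.congr_fderiv ?_
  have hc : Continuous fun s => fderiv ℝ (fun v => L (φ s (x, v))) v := (continuous_fderiv_left hcd).comp (Continuous.prodMk_right v)
  ext1 w
  rw [ContinuousLinearMap.intervalIntegral_apply (hc.intervalIntegrable _ _)]
  set D := fun s => fderiv ℝ (fun v : E n => φ s (x, v)) v w with hD
  have hfd : ∀ s, fderiv ℝ (fun v => L (φ s (x, v))) v w =
      partialX n L (φ s (x, v)).1 (φ s (x, v)).2 (D s).1 +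
        partialV n L (φ s (x, v)).1 (φ s (x, v)).2 (D s).2 := fun s => by
    have h1 := ((hLd (φ s (x, v))).hasFDerivAt.comp v
      (hφ.differentiable_fiber hk x s v).hasFDerivAt).fderiv
    rw [← fderiv_eq_partial hLd]
    exact congrArg (· w) h1
  have hb : ∀ s, HasDerivAt (fun s => partialV n L (φ s (x, v)).1 (φ s (x, v)).2 (D s).1)
      (fderiv ℝ (fun v => L (φ s (x, v))) v w) s := fun s => by
    rw [hfd]
    exact (hφ.hasDerivAt_partialV x v s).clm_apply (hφ.hasDerivAt_jacobi hk x v w s)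
  have h0 : (D 0).1 = 0 := by
    simp only [hD, hφ.2.1]
    rw [(hasFDerivAt_prodMk_right x v).fderiv]
    simp
  rw [intervalIntegral.integral_eq_sub_of_hasDerivAt (fun s _ => hb s)
    ((hc.clm_apply continuous_const).intervalIntegrable _ _), h0]
  simp [hD]

/-- The mean velocity over `[0, t]` of the extremal issued from `(x, v)`. -/
def meanVelocity (φ : ℝ → E n × E n → E n × E n) (x : E n) (t : ℝ) (v : E n) : E n :=
  ∫ u in (0 : ℝ)..1, (φ (u * t) (x, v)).2

theorem IsELFlow.add_smul_meanVelocity (hφ : IsELFlow n k L φ) (hk : 2 ≤ k) (x v : E n)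
    (t : ℝ) : x + t • meanVelocity φ x t v = (φ t (x, v)).1 := by
  rw [hφ.fst_eq_add_integral hk, meanVelocity,
    intervalIntegral.smul_integral_comp_mul_right (fun s => (φ s (x, v)).2)]
  simp

theorem IsELFlow.meanVelocity_zero (hφ : IsELFlow n k L φ) (x v : E n) :
    meanVelocity φ x 0 v = v := by
  simp [meanVelocity, hφ.2.1]

theorem IsELFlow.contDiff_rescaled (hφ : IsELFlow n k L φ) (hk : 2 ≤ k) (x : E n) :
    ContDiff ℝ 1 (Function.uncurry fun (p : ℝ × E n) (u : ℝ) => φ (u * p.1) (x, p.2)) :=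
  (hφ.contDiff_one hk).comp
    (f := fun q : (ℝ × E n) × ℝ => (q.2 * q.1.1, (x, q.1.2))) (by fun_prop)

theorem IsELFlow.exists_hasStrictFDerivAt_meanVelocity (hφ : IsELFlow n k L φ) (hk : 2 ≤ k)
    (x : E n) (p : ℝ × E n) :
    ∃ G' : ℝ × E n →L[ℝ] E n, HasStrictFDerivAt (fun p : ℝ × E n => meanVelocity φ x p.1 p.2) G' p :=
  ⟨_, hasStrictFDerivAt_intervalIntegral
    (f := fun (p : ℝ × E n) (u : ℝ) => (φ (u * p.1) (x, p.2)).2)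
    (contDiff_snd.comp (hφ.contDiff_rescaled hk x)) 0 1 p⟩

theorem IsELFlow.exists_hasFDerivAt_action (hφ : IsELFlow n k L φ) (hk : 2 ≤ k)
    (hL : ContDiff ℝ 1 L) (x : E n) (p : ℝ × E n) :
    ∃ A' : ℝ × E n →L[ℝ] ℝ, HasFDerivAt (fun p : ℝ × E n => ∫ s in (0 : ℝ)..p.1, L (φ s (x, p.2))) A' p := by
  have h := (hasStrictFDerivAt_intervalIntegral
    (f := fun (p : ℝ × E n) (u : ℝ) => L (φ (u * p.1) (x, p.2)))
    (hL.comp (hφ.contDiff_rescaled hk x)) 0 1 p).hasFDerivAt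
  have h' := (hasFDerivAt_fst (𝕜 := ℝ) (E := ℝ) (F := E n) (p := p)).smul h
  refine ⟨_, h'.congr_of_eventuallyEq (.of_forall fun q => ?_)⟩
  change _ = q.1 • ∫ u in (0 : ℝ)..1, L (φ (u * q.1) (x, q.2))
  rw [intervalIntegral.smul_integral_comp_mul_right (fun s => L (φ s (x, q.2)))]
  simp

/-- Along velocities `w` for which the extremal reaches `x + t • z` at time `t`, the action grows
at most as fast as along the line `t ↦ x + t • z`. -/
theorem IsELFlow.exists_hasDerivAt_action_le (hφ : IsELFlow n k L φ) (hk : 2 ≤ k)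
    (hL : IsTonelliLagrangian n k L) {x z : E n} {t : ℝ} {w : ℝ → E n}
    (hw : DifferentiableAt ℝ w t) (hz : ∀ᶠ s in 𝓝 t, (φ s (x, w s)).1 = x + s • z) :
    ∃ a, HasDerivAt (fun t => ∫ s in (0 : ℝ)..t, L (φ s (x, w t))) a t ∧
      a ≤ L (x + t • z, z) := by
  have hL2 := hL.contDiff_two (by exact_mod_cast hk)
  have hL1 : ContDiff ℝ 1 L := hL2.of_le one_le_two
  obtain ⟨A', hA⟩ := hφ.exists_hasFDerivAt_action hk hL1 x (t, w t)
  set w' := deriv w t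
  have hpair : HasDerivAt (fun s => (s, w s)) (1, w') t := (hasDerivAt_id t).prodMk hw.hasDerivAt
  have hA0 : A' (1, 0) = L (φ t (x, w t)) := by
    have h1 : HasDerivAt (fun s => ∫ u in (0 : ℝ)..s, L (φ u (x, w t))) (A' (1, 0)) t :=
      HasFDerivAt.comp_hasDerivAt (f := fun s => (s, w t)) t hA
        ((hasDerivAt_id t).prodMk (hasDerivAt_const t (w t)))
    have hc : Continuous fun u => L (φ u (x, w t)) :=
      hL1.continuous.comp ((hφ.contDiff_fiber hk x).continuous.comp (Continuous.prodMk_right (w t)))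
    exact h1.unique (intervalIntegral.integral_hasDerivAt_right (hc.intervalIntegrable _ _)
      hc.stronglyMeasurable.stronglyMeasurableAtFilter hc.continuousAt)
  have hA1 : A' (0, w') = partialV n L (φ t (x, w t)).1 (φ t (x, w t)).2
      (fderiv ℝ (fun v : E n => φ t (x, v)) (w t) w').1 := by
    have h1 := HasFDerivAt.comp (f := fun v => (t, v)) (w t) hA (hasFDerivAt_prodMk_right t (w t))
    exact congrArg (· w') (h1.unique (hφ.hasFDerivAt_action hk hL1 x (w t) t))
  have hF : (φ t (x, w t)).2 + (fderiv ℝ (fun v : E n => φ t (x, v)) (w t) w').1 = z := by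
    obtain ⟨F', hd⟩ : DifferentiableAt ℝ (fun p : ℝ × E n => (φ p.1 (x, p.2)).1) (t, w t) :=
      (((hφ.contDiff_one hk).differentiable one_ne_zero).comp
        (f := fun p : ℝ × E n => (p.1, (x, p.2))) (by fun_prop) (t, w t)).fst
    have h0 : F' (1, 0) = (φ t (x, w t)).2 :=
      (HasFDerivAt.comp_hasDerivAt (f := fun s => (s, w t)) t hd
        ((hasDerivAt_id t).prodMk (hasDerivAt_const t (w t)))).unique (hφ.hasDerivAt_fst x (w t) t)
    have h1 : F' (0, w') = (fderiv ℝ (fun v : E n => φ t (x, v)) (w t) w').1 :=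
      congrArg (· w') ((HasFDerivAt.comp (f := fun v => (t, v)) (w t) hd
        (hasFDerivAt_prodMk_right t (w t))).unique
        (hφ.differentiable_fiber hk x t (w t)).hasFDerivAt.fst)
    rw [← h0, ← h1, ← map_add, Prod.mk_add_mk, add_zero, zero_add]
    have h2 : HasDerivAt (fun s => x + s • z) ((1 : ℝ) • z) t :=
      ((hasDerivAt_id t).smul_const z).const_add x
    rw [one_smul] at h2
    exact ((HasFDerivAt.comp_hasDerivAt (f := fun s => (s, w s)) t hd hpair).congr_of_eventuallyEq
      (hz.mono fun s hs => hs.symm)).unique h2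
  refine ⟨A' (1, w'), HasFDerivAt.comp_hasDerivAt (f := fun s => (s, w s)) t hA hpair, ?_⟩
  have hsplit : A' (1, w') = A' (1, 0) + A' (0, w') := by rw [← map_add]; simp
  rw [hsplit, hA0, hA1, eq_sub_of_add_eq' hF, ← hz.self_of_nhds]
  exact add_partialV_le hL2 hL.posdef _ _ _

end Flow

section Lift

variable {n k : ℕ} {L : E n × E n → ℝ} {φ : ℝ → E n × E n → E n × E n}

/-- The map `(t, v) ↦ (t, meanVelocity φ x t v)`. -/
def timeMeanVelocity (φ : ℝ → E n × E n → E n × E n) (x : E n) (p : ℝ × E n) : ℝ × E n :=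
  (p.1, meanVelocity φ x p.1 p.2)

theorem exists_hasStrictFDerivAt_timeMeanVelocity (hφ : IsELFlow n k L φ) (hk : 2 ≤ k)
    (hnc : NoConjugatePoints n φ) (x : E n) (p : ℝ × E n) :
    ∃ e : (ℝ × E n) ≃L[ℝ] (ℝ × E n),
      HasStrictFDerivAt (timeMeanVelocity φ x) (e : (ℝ × E n) →L[ℝ] (ℝ × E n)) p := by
  obtain ⟨G', hG⟩ := hφ.exists_hasStrictFDerivAt_meanVelocity hk x p
  obtain ⟨t, v⟩ := p
  have hfib : HasFDerivAt (meanVelocity φ x t) (G'.comp (ContinuousLinearMap.inr ℝ ℝ (E n))) v :=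
    HasFDerivAt.comp (f := fun v => (t, v)) v hG.hasFDerivAt (hasFDerivAt_prodMk_right t v)
  have hker : ∀ w, G' (0, w) = 0 → w = 0 := fun w hw => by
    rcases eq_or_ne t 0 with rfl | ht
    · have h0 : meanVelocity φ x 0 = id := funext (hφ.meanVelocity_zero x)
      rw [h0] at hfib
      have h1 := congrArg (· w) (hfib.unique (hasFDerivAt_id v))
      simpa [hw] using h1.symm
    · refine hnc (x, v) t ht w ?_
      have h1 := (hφ.differentiable_fiber hk x t v).hasFDerivAt.fst
      simp only [← hφ.add_smul_meanVelocity hk] at h1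
      have h2 := congrArg (· w) (h1.unique ((hfib.const_smul t).const_add x))
      rw [← hφ.fderiv_fiber hk]
      simpa [hw] using h2
  set D : (ℝ × E n) →L[ℝ] (ℝ × E n) := (ContinuousLinearMap.fst ℝ ℝ (E n)).prod G' with hD
  have hinj : Function.Injective (D : (ℝ × E n) →ₗ[ℝ] (ℝ × E n)) := by
    refine (injective_iff_map_eq_zero _).2 ?_
    rintro ⟨s, w⟩ h
    obtain ⟨rfl, h2⟩ : s = 0 ∧ G' (s, w) = 0 := by simpa [hD] using h
    rw [hker w h2, Prod.mk_zero_zero]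
  refine ⟨(LinearEquiv.ofInjectiveEndo _ hinj).toContinuousLinearEquiv, ?_⟩
  exact (hasStrictFDerivAt_fst.prodMk hG : HasStrictFDerivAt (timeMeanVelocity φ x) D (t, v))

theorem isLocalHomeomorph_timeMeanVelocity (hφ : IsELFlow n k L φ) (hk : 2 ≤ k)
    (hnc : NoConjugatePoints n φ) (x : E n) : IsLocalHomeomorph (timeMeanVelocity φ x) := by
  intro p
  obtain ⟨e, he⟩ := exists_hasStrictFDerivAt_timeMeanVelocity hφ hk hnc x p
  exact ⟨he.toOpenPartialHomeomorph _, he.mem_toOpenPartialHomeomorph_source, rfl⟩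

/-- On `[0, τ]`, the curve `w` consists of velocities, starting from `z`, such that the extremal
issued from `(x, w t)` has mean velocity `z` over `[0, t]`. -/
structure IsVelocityLift (φ : ℝ → E n × E n → E n × E n) (x z : E n) (τ : ℝ) (w : ℝ → E n) :
    Prop where
  continuousOn : ContinuousOn w (Icc 0 τ)
  zero : w 0 = z
  meanVelocity_eq : ∀ t ∈ Icc 0 τ, meanVelocity φ x t (w t) = z

theorem IsVelocityLift.differentiableAt (hφ : IsELFlow n k L φ) (hk : 2 ≤ k)
    (hnc : NoConjugatePoints n φ) {x z : E n} {τ : ℝ} {w : ℝ → E n}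
    (hw : IsVelocityLift φ x z τ w) {t : ℝ} (ht : t ∈ Ioo 0 τ) : DifferentiableAt ℝ w t := by
  have hIcc : Icc 0 τ ∈ 𝓝 t := Icc_mem_nhds ht.1 ht.2
  obtain ⟨e, he⟩ := exists_hasStrictFDerivAt_timeMeanVelocity hφ hk hnc x (t, w t)
  have hc : Tendsto (fun s => (s, w s)) (𝓝 t) (𝓝 (t, w t)) :=
    continuousAt_id.prodMk (hw.continuousOn.continuousAt hIcc)
  have hg := he.to_localInverse.hasFDerivAt.differentiableAt
  rw [timeMeanVelocity, hw.meanVelocity_eq t ⟨ht.1.le, ht.2.le⟩] at hg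
  have hd : DifferentiableAt ℝ (fun s => (he.localInverse _ _ _ (s, z)).2) t :=
    (DifferentiableAt.comp (f := fun s : ℝ => (s, z)) t hg (by fun_prop)).snd
  refine hd.congr_of_eventuallyEq ?_
  filter_upwards [hc.eventually he.eventually_left_inverse, hIcc] with s hs hs'
  rw [timeMeanVelocity, hw.meanVelocity_eq s hs'] at hs
  rw [hs]

theorem IsVelocityLift.action_le (hφ : IsELFlow n k L φ) (hk : 2 ≤ k)
    (hL : IsTonelliLagrangian n k L) (hnc : NoConjugatePoints n φ) {x z : E n} {τ C : ℝ}
    {w : ℝ → E n} (hw : IsVelocityLift φ x z τ w) (hτ : 0 ≤ τ)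
    (hC : ∀ t ∈ Icc 0 τ, L (x + t • z, z) ≤ C) :
    ∫ s in (0 : ℝ)..τ, L (φ s (x, w τ)) ≤ C * τ := by
  have hL1 : ContDiff ℝ 1 L := (hL.contDiff_two (by exact_mod_cast hk)).of_le one_le_two
  have hder : ∀ t ∈ Ioo 0 τ, ∃ a, HasDerivAt (fun t => ∫ s in (0 : ℝ)..t, L (φ s (x, w t))) a t ∧
      a ≤ C := fun t ht => by
    obtain ⟨a, ha, hle⟩ := hφ.exists_hasDerivAt_action_le hk hL
      (hw.differentiableAt hφ hk hnc ht) (z := z) (x := x) (by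
        filter_upwards [Icc_mem_nhds ht.1 ht.2] with s hs
        rw [← hφ.add_smul_meanVelocity hk, hw.meanVelocity_eq s hs])
    exact ⟨a, ha, hle.trans (hC t ⟨ht.1.le, ht.2.le⟩)⟩
  have hcont : Continuous (fun p : ℝ × E n => ∫ s in (0 : ℝ)..p.1, L (φ s (x, p.2))) :=
    continuous_iff_continuousAt.2 fun p =>
      (hφ.exists_hasFDerivAt_action hk hL1 x p).choose_spec.continuousAt
  have hanti : AntitoneOn (fun t => (∫ s in (0 : ℝ)..t, L (φ s (x, w t))) - C * t)
      (Icc 0 τ) := by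
    refine antitoneOn_of_deriv_nonpos (convex_Icc 0 τ) ?_ ?_ ?_
    · exact (hcont.comp_continuousOn (continuousOn_id.prodMk hw.continuousOn)).sub
        (by fun_prop)
    · rw [interior_Icc]
      intro t ht
      obtain ⟨a, ha, -⟩ := hder t ht
      exact (ha.differentiableAt.sub (by fun_prop)).differentiableWithinAt
    · rw [interior_Icc]
      intro t ht
      obtain ⟨a, ha, hle⟩ := hder t ht
      have h1 := ha.sub ((hasDerivAt_id t).const_mul C)
      rw [mul_one] at h1
      exact h1.deriv.trans_le (sub_nonpos.2 hle)
  have h := hanti (left_mem_Icc.2 hτ) (right_mem_Icc.2 hτ) hτ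
  simpa using h

theorem exists_norm_velocityLift_le (hφ : IsELFlow n k L φ) (hk : 2 ≤ k)
    (hL : IsTonelliLagrangian n k L) (hnc : NoConjugatePoints n φ) (x z : E n) (T : ℝ) :
    ∃ B, ∀ τ ∈ Icc 0 T, ∀ w, IsVelocityLift φ x z τ w → ‖w τ‖ ≤ B := by
  have hk' : (2 : ℕ∞) ≤ k := by exact_mod_cast hk
  have hL1 : ContDiff ℝ 1 L := (hL.contDiff_two hk').of_le one_le_two
  obtain ⟨C, hC⟩ := (isCompact_Icc (a := (0 : ℝ)) (b := T)).exists_bound_of_continuousOn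
    (f := fun t : ℝ => L (x + t • z, z))
    (hL1.continuous.comp (by fun_prop : Continuous fun t : ℝ => (x + t • z, z))).continuousOn
  obtain ⟨R, hR⟩ := hL.superlinear 1
  obtain ⟨C', hC'⟩ := hL.exists_energy_le (one_le_two.trans hk') (max R (C + 1))
  obtain ⟨B, hB⟩ := hL.exists_norm_le_of_energy_le hk' x C'
  refine ⟨max ‖z‖ B, fun τ hτ w hw => ?_⟩
  rcases hτ.1.eq_or_lt with h0 | h0
  · rw [← h0, hw.zero]
    exact le_max_left _ _
  have hact := hw.action_le hφ hk hL hnc h0.le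
    (fun t ht => (le_abs_self _).trans (hC t ⟨ht.1, ht.2.trans hτ.2⟩))
  obtain ⟨s, hs⟩ : ∃ s, L (φ s (x, w τ)) ≤ C + 1 := by
    by_contra! hlt
    have hc : Continuous fun s => L (φ s (x, w τ)) :=
      hL1.continuous.comp ((hφ.contDiff_fiber hk x).continuous.comp (Continuous.prodMk_right (w τ)))
    have hmono := intervalIntegral.integral_mono_on (a := 0) (b := τ) (μ := volume)
      (f := fun _ => C + 1) h0.le
      intervalIntegrable_const (hc.intervalIntegrable 0 τ) (fun s _ => (hlt s).le)
    simp only [intervalIntegral.integral_const, sub_zero, smul_eq_mul] at hmono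
    linarith
  refine (hB _ ?_).trans (le_max_right _ _)
  rw [← hφ.energy_eq (hL1.differentiable one_ne_zero) x (w τ) s]
  refine hC' _ _ ?_
  by_contra! hlt
  obtain ⟨h1, h2⟩ := max_lt_iff.1 hlt
  have h3 := hR (φ s (x, w τ)).1 (φ s (x, w τ)).2 h1.le
  rw [one_mul] at h3
  linarith

/-- If velocity lifts exist up to times `σ m` accumulating at `τ`, with endpoints accumulating at
`v`, then velocity lifts exist slightly beyond `τ`. -/
theorem exists_isVelocityLift_extension (hφ : IsELFlow n k L φ) (hk : 2 ≤ k)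
    (hnc : NoConjugatePoints n φ) {x z v : E n} {τ : ℝ} {σ : ℕ → ℝ} {w : ℕ → ℝ → E n}
    (hσ0 : ∀ m, 0 ≤ σ m) (hw : ∀ m, IsVelocityLift φ x z (σ m) (w m))
    (hσ : Tendsto σ atTop (𝓝 τ)) (hv : Tendsto (fun m => w m (σ m)) atTop (𝓝 v)) :
    ∀ᶠ t in 𝓝 τ, ∃ u, IsVelocityLift φ x z t u := by
  obtain ⟨e, hev, he⟩ := isLocalHomeomorph_timeMeanVelocity hφ hk hnc x (τ, v)
  have hval : ∀ m, timeMeanVelocity φ x (σ m, w m (σ m)) = (σ m, z) := fun m => by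
    rw [timeMeanVelocity, (hw m).meanVelocity_eq _ (right_mem_Icc.2 (hσ0 m))]
  have hlim : e (τ, v) = (τ, z) := by
    refine tendsto_nhds_unique ((e.continuousAt hev).tendsto.comp (hσ.prodMk_nhds hv)) ?_
    refine (hσ.prodMk_nhds tendsto_const_nhds).congr fun m => ?_
    rw [← hval, he]
    rfl
  have htgt : ∀ᶠ t in 𝓝 τ, (t, z) ∈ e.target := by
    refine (by fun_prop : Continuous fun t : ℝ => (t, z)).continuousAt.eventually_mem ?_
    exact e.open_target.mem_nhds (hlim ▸ e.map_source hev)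
  obtain ⟨ε, hε, hball⟩ := Metric.eventually_nhds_iff_ball.1 htgt
  have hσball : ∀ᶠ m in atTop, σ m ∈ Metric.ball τ ε := hσ.eventually (Metric.ball_mem_nhds τ hε)
  obtain ⟨m, hm1, hm2⟩ := (hσball.and
    ((hσ.prodMk_nhds hv).eventually (e.open_source.mem_nhds hev))).exists
  have hsymm : ∀ t ∈ Metric.ball τ ε, (e.symm (t, z)).1 = t ∧
      meanVelocity φ x t (e.symm (t, z)).2 = z := fun t ht => by
    have h1 := e.right_inv (hball t ht)
    rw [← he] at h1
    obtain ⟨h2, h3⟩ := Prod.ext_iff.1 h1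
    simp only [timeMeanVelocity] at h2 h3
    exact ⟨h2, by rwa [h2] at h3⟩
  have hglue : (e.symm (σ m, z)).2 = w m (σ m) := by
    rw [← hval, he, e.left_inv hm2]
  filter_upwards [Metric.ball_mem_nhds τ hε] with t ht
  refine ⟨fun s => if s ≤ σ m then w m s else (e.symm (s, z)).2, ?_, ?_, ?_⟩
  · refine ContinuousOn.if ?_ ?_ ?_
    · rintro s ⟨-, hs⟩
      have hs' : s = σ m := frontier_le_subset_eq continuous_id continuous_const hs
      rw [hs', hglue]
    · refine (hw m).continuousOn.mono fun s hs => ?_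
      exact ⟨hs.1.1, closure_le_eq continuous_id continuous_const |>.le hs.2⟩
    · refine continuous_snd.comp_continuousOn (e.continuousOn_symm.comp (by fun_prop) ?_)
      rintro s ⟨hs1, hs2⟩
      have h2 : σ m ≤ s := by
        simp only [not_le] at hs2
        exact closure_lt_subset_le continuous_const continuous_id hs2
      exact hball s ((convex_ball τ ε).ordConnected.out hm1 ht ⟨h2, hs1.2⟩)
  · rw [if_pos (hσ0 m), (hw m).zero]
  · intro s hs
    split_ifs with h
    · exact (hw m).meanVelocity_eq s ⟨hs.1, h⟩
    · exact (hsymm s ((convex_ball τ ε).ordConnected.out hm1 ht ⟨(not_le.1 h).le, hs.2⟩)).2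

theorem exists_isVelocityLift (hφ : IsELFlow n k L φ) (hk : 2 ≤ k)
    (hL : IsTonelliLagrangian n k L) (hnc : NoConjugatePoints n φ) (x z : E n) {T : ℝ}
    (hT : 0 ≤ T) : ∃ w, IsVelocityLift φ x z T w := by
  set S : Set ℝ := {t | ∃ w, IsVelocityLift φ x z |t| w} with hS
  have hclos : ∀ τ ∈ closure S, S ∈ 𝓝 τ := fun τ hτ => by
    obtain ⟨σ, hσS, hσ⟩ := mem_closure_iff_seq_limit.1 hτ
    choose w hw using hσS
    have hσ' : Tendsto (fun m => |σ m|) atTop (𝓝 |τ|) := hσ.abs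
    obtain ⟨B, hB⟩ := exists_norm_velocityLift_le hφ hk hL hnc x z (|τ| + 1)
    have hbdd : ∃ᶠ m in atTop, w m |σ m| ∈ Metric.closedBall (0 : E n) B := by
      refine Eventually.frequently ?_
      filter_upwards [hσ'.eventually (ge_mem_nhds (lt_add_one |τ|))] with m hm
      simpa using hB |σ m| ⟨abs_nonneg _, hm⟩ (w m) (hw m)
    obtain ⟨v, -, ι, hι, hv⟩ := tendsto_subseq_of_frequently_bounded
      Metric.isBounded_closedBall hbdd
    exact continuous_abs.continuousAt.eventually (exists_isVelocityLift_extension hφ hk hnc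
      (σ := fun m => |σ (ι m)|) (w := fun m => w (ι m)) (fun m => abs_nonneg _)
      (fun m => hw (ι m)) (hσ'.comp hι.tendsto_atTop) hv)
  have h0 : (0 : ℝ) ∈ S := ⟨fun _ => z, continuousOn_const, rfl, fun t ht => by
    simp only [abs_zero, Icc_self, mem_singleton_iff] at ht
    rw [ht, hφ.meanVelocity_zero]⟩
  have huniv : S = univ := IsClopen.eq_univ
    ⟨isClosed_of_closure_subset fun τ hτ => mem_of_mem_nhds (hclos τ hτ),
      isOpen_iff_mem_nhds.2 fun τ hτ => hclos τ (subset_closure hτ)⟩ ⟨0, h0⟩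
  have hTS : T ∈ S := huniv ▸ mem_univ T
  simpa only [hS, mem_ofPred_eq, abs_of_nonneg hT] using hTS

/-- For `T ≥ 0`, the map `v ↦ meanVelocity φ x T v` has a continuous right inverse. -/
theorem exists_continuous_rightInverse_meanVelocity (hφ : IsELFlow n k L φ) (hk : 2 ≤ k)
    (hL : IsTonelliLagrangian n k L) (hnc : NoConjugatePoints n φ) (x : E n) {T : ℝ}
    (hT : 0 ≤ T) : ∃ ψ : E n → E n, Continuous ψ ∧ ∀ z, meanVelocity φ x T (ψ z) = z := by
  choose w hw using fun z => exists_isVelocityLift hφ hk hL hnc x z hT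
  have hmem : ∀ s : unitInterval, (s : ℝ) * T ∈ Icc 0 T := fun s =>
    ⟨mul_nonneg s.2.1 hT, mul_le_of_le_one_left hT s.2.2⟩
  have hg := (isLocalHomeomorph_timeMeanVelocity hφ hk hnc x).continuous_lift
    (T2Space.isSeparatedMap _)
    (f := ⟨fun q : unitInterval × E n => ((q.1 : ℝ) * T, q.2), by fun_prop⟩)
    (g := fun q => ((q.1 : ℝ) * T, w q.2 (q.1 * T)))
    (by
      ext1 q
      simp [timeMeanVelocity, (hw q.2).meanVelocity_eq _ (hmem q.1)])
    (by simpa [(hw _).zero] using (by fun_prop : Continuous fun z : E n => ((0 : ℝ), z)))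
    (fun z => (by fun_prop : Continuous fun s : unitInterval => (s : ℝ) * T).prodMk
      ((hw z).continuousOn.comp_continuous (by fun_prop) hmem))
  refine ⟨fun z => w z T, ?_, fun z => (hw z).meanVelocity_eq T (right_mem_Icc.2 hT)⟩
  simpa [Function.comp_def] using
    (continuous_snd.comp hg).comp (Continuous.prodMk_right (1 : unitInterval))

theorem exists_continuous_inverse_meanVelocity (hφ : IsELFlow n k L φ) (hk : 2 ≤ k)
    (hL : IsTonelliLagrangian n k L) (hnc : NoConjugatePoints n φ) (x : E n) {T : ℝ}
    (hT : 0 ≤ T) : ∃ ψ : E n → E n, Continuous ψ ∧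
      Function.LeftInverse ψ (meanVelocity φ x T) ∧
      Function.RightInverse ψ (meanVelocity φ x T) := by
  obtain ⟨ψ, hψ, hr⟩ := exists_continuous_rightInverse_meanVelocity hφ hk hL hnc x hT
  have hΦ := isLocalHomeomorph_timeMeanVelocity hφ hk hnc x
  have hG : Continuous (meanVelocity φ x T) :=
    continuous_snd.comp (hΦ.continuous.comp (Continuous.prodMk_right T))
  have huniv : {v | ψ (meanVelocity φ x T v) = v} = univ := by
    refine IsClopen.eq_univ ⟨isClosed_eq (hψ.comp hG) continuous_id, ?_⟩
      ⟨ψ 0, congrArg ψ (hr 0)⟩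
    refine isOpen_iff_mem_nhds.2 fun v hv => ?_
    obtain ⟨e, hev, he⟩ := hΦ (T, v)
    have h1 : ∀ᶠ v' in 𝓝 v, (T, v') ∈ e.source :=
      (Continuous.prodMk_right T).continuousAt.eventually_mem (e.open_source.mem_nhds hev)
    have h2 : Tendsto (fun v => ψ (meanVelocity φ x T v)) (𝓝 v) (𝓝 v) := by
      have h := (hψ.comp hG).tendsto v
      rwa [Function.comp_apply, show ψ (meanVelocity φ x T v) = v from hv] at h
    filter_upwards [h1, h2.eventually h1] with v' h3 h4
    have h5 : e (T, ψ (meanVelocity φ x T v')) = e (T, v') := by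
      rw [← he]
      simp [timeMeanVelocity, hr]
    exact (Prod.ext_iff.1 (e.injOn h4 h3 h5)).2
  exact ⟨ψ, hψ, fun v => huniv.ge (mem_univ v), hr⟩

end Lift

/-- For a Tonelli Lagrangian without conjugate points, for every `t > 0`
and `x ∈ ℝⁿ`, the map `F : v ↦ π (φ_t (x, v))` is a `C^{k-1}` diffeomorphism of `ℝⁿ`
onto `ℝⁿ`. -/
theorem exp_map_diffeomorphism (n k : ℕ) (hn : 1 ≤ n) (hk : 2 ≤ k)
    (L : E n × E n → ℝ) (hL : IsTonelliLagrangian n (k : ℕ∞) L)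
    (φ : ℝ → E n × E n → E n × E n) (hφ : IsELFlow n k L φ)
    (hnc : NoConjugatePoints n φ) :
    ∀ t : ℝ, 0 < t → ∀ x : E n, ∃ Finv : E n → E n,
      Function.LeftInverse Finv (fun v : E n => (φ t (x, v)).1) ∧
      Function.RightInverse Finv (fun v : E n => (φ t (x, v)).1) ∧
      ContDiff ℝ ((k - 1 : ℕ) : ℕ∞) (fun v : E n => (φ t (x, v)).1) ∧
      ContDiff ℝ ((k - 1 : ℕ) : ℕ∞) Finv := by
  intro t ht x
  obtain ⟨ψ, hψ, hl, hr⟩ := exists_continuous_inverse_meanVelocity hφ hk hL hnc x ht.le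
  have hF : ∀ v, (φ t (x, v)).1 = x + t • meanVelocity φ x t v := fun v =>
    (hφ.add_smul_meanVelocity hk x v t).symm
  have hcd : ContDiff ℝ ((k - 1 : ℕ) : ℕ∞) (fun v : E n => (φ t (x, v)).1) :=
    contDiff_fst.comp (hφ.1.comp
      (f := fun v : E n => (t, (x, v))) (by fun_prop))
  let F : E n ≃ₜ E n :=
    { toFun := fun v => (φ t (x, v)).1
      invFun := fun y => ψ (t⁻¹ • (y - x))
      left_inv := fun v => by
        simp only [hF, add_sub_cancel_left, inv_smul_smul₀ ht.ne']
        exact hl v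
      right_inv := fun y => by
        simp only [hF]
        rw [hr, smul_inv_smul₀ ht.ne', add_sub_cancel]
      continuous_toFun := hcd.continuous
      continuous_invFun := by fun_prop }
  have hder : ∀ v, ∃ e : E n ≃L[ℝ] E n, HasFDerivAt F (e : E n →L[ℝ] E n) v := fun v => by
    have h1 := (hφ.differentiable_fiber hk x t v).hasFDerivAt.fst
    set D := (ContinuousLinearMap.fst ℝ (E n) (E n)).comp
      (fderiv ℝ (fun v : E n => φ t (x, v)) v) with hD
    have hinj : Function.Injective (D : E n →ₗ[ℝ] E n) :=
      (injective_iff_map_eq_zero _).2 fun w hw => hnc (x, v) t ht.ne' w (by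
        rw [← hφ.fderiv_fiber hk]
        exact hw)
    exact ⟨(LinearEquiv.ofInjectiveEndo _ hinj).toContinuousLinearEquiv, h1⟩
  choose e he using hder
  exact ⟨F.symm, F.left_inv, F.right_inv, hcd, F.contDiff_symm he hcd⟩

end
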